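/- arXiv:2510.11109 — 9 statements merged into one kernel-verified Lean document; each statement's English description precedes it below -/
import Mathlib

section
/- Let T ⊆ E be a set of directed edges such that: every vertex incident to a T-edge other than s has exactly one incoming T-edge; s has no incoming T-edge; T has no directed cycles; every destination k ∈ D is reachable from s along T-edges; and the unique T-parent of each destination is not a destination. For a T-edge (i,j) define the downstream maximum m(i,j) := max({x k : k ∈ D, j = k or k is reachable from j along T-edges} ∪ {0}). Suppose f is an optimal flow, e i j > 0 for every (i,j) ∈ E, and the support of f is exactly T (f i j > 0 iff (i,j) ∈ T). Then f i j = m(i,j) for every (i,j) ∈ T: on each link shared to transmit flow to multiple destinations, the flow equals the maximum demand among the downstream destination nodes. -/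
noncomputable section

open scoped Classical

/-- `out(f,i)`: the maximum outflow value of node `i`, taken over the finite node type. -/
def flowOut {V : Type*} [Fintype V] [Nonempty V] (f : V → V → ℝ) (i : V) : ℝ :=
  Finset.univ.sup' Finset.univ_nonempty (fun j => f i j)

/-- `in(f,i)`: the maximum inflow value of node `i`, taken over the finite node type. -/
def flowIn {V : Type*} [Fintype V] [Nonempty V] (f : V → V → ℝ) (i : V) : ℝ :=
  Finset.univ.sup' Finset.univ_nonempty (fun j => f j i)

/-- Feasibility of a flow `f` for the minimum-flow multicast problem:
(N) nonnegativity, (S) support confined to the edge set `E`,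
(C1) out ≤ in at every non-source node, (C2) the source outflow covers the
largest demand, (C3) each destination `j ∈ D` receives at least `x j` from
some non-destination node. -/
def Feasible {V : Type*} [Fintype V] [Nonempty V] [DecidableEq V]
    (E : Set (V × V)) (s : V) (D : Finset V)
    (hD : D.Nonempty) (hsD : s ∉ D) (x : V → ℝ) (f : V → V → ℝ) : Prop :=
  (∀ i j, 0 ≤ f i j) ∧
  (∀ i j, (i, j) ∉ E → f i j = 0) ∧
  (∀ i, i ≠ s → flowOut f i ≤ flowIn f i) ∧
  (D.sup' hD x ≤ flowOut f s) ∧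
  (∀ j ∈ D, x j ≤ (Finset.univ \ D).sup'
      ⟨s, Finset.mem_sdiff.mpr ⟨Finset.mem_univ s, hsD⟩⟩ (fun i => f i j))

/-- Total transmission cost of a flow. -/
def cost {V : Type*} [Fintype V] (e f : V → V → ℝ) : ℝ :=
  ∑ i, ∑ j, e i j * f i j

/-- Maximum downstream demand below node `j` along `T`-edges:
`max ({x k : k ∈ D, j = k or k reachable from j along T} ∪ {0})`. -/
noncomputable def mval {V : Type*} (T : Set (V × V)) (D : Finset V) (x : V → ℝ) (j : V) : ℝ :=
  (D.filter (fun k => j = k ∨ Relation.ReflTransGen (fun a b => (a, b) ∈ T) j k)).fold max 0 x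

/-- `mval T D x j` is the least upper bound of `0` and the demands downstream of `j`. -/
lemma mval_le_iff {V : Type*} {T : Set (V × V)} {D : Finset V} {x : V → ℝ} {j : V} {c : ℝ} :
    mval T D x j ≤ c ↔
      0 ≤ c ∧ ∀ k ∈ D, Relation.ReflTransGen (fun a b => (a, b) ∈ T) j k → x k ≤ c := by
  unfold mval
  rw [Finset.fold_max_le]
  refine and_congr_right fun _ => ⟨fun h k hk hjk => ?_, fun h k hk => ?_⟩
  · exact h k (Finset.mem_filter.mpr ⟨hk, Or.inr hjk⟩)
  · obtain ⟨hk, rfl | hjk⟩ := Finset.mem_filter.mp hk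
    · exact h _ hk .refl
    · exact h k hk hjk

lemma mval_nonneg {V : Type*} (T : Set (V × V)) (D : Finset V) (x : V → ℝ) (j : V) :
    0 ≤ mval T D x j :=
  (mval_le_iff.mp le_rfl).1

lemma le_mval {V : Type*} {T : Set (V × V)} {D : Finset V} {x : V → ℝ} {j k : V} (hk : k ∈ D)
    (hjk : Relation.ReflTransGen (fun a b => (a, b) ∈ T) j k) : x k ≤ mval T D x j :=
  (mval_le_iff.mp le_rfl).2 k hk hjk

lemma mval_le_mval_of_edge {V : Type*} {T : Set (V × V)} {D : Finset V} {x : V → ℝ} {i j : V}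
    (hij : (i, j) ∈ T) : mval T D x j ≤ mval T D x i :=
  mval_le_iff.mpr ⟨mval_nonneg T D x i, fun _ hk hjk => le_mval hk (.head hij hjk)⟩

lemma le_flowOut {V : Type*} [Fintype V] [Nonempty V] (f : V → V → ℝ) (i j : V) :
    f i j ≤ flowOut f i :=
  Finset.le_sup' (fun j => f i j) (Finset.mem_univ j)

lemma le_flowIn {V : Type*} [Fintype V] [Nonempty V] (f : V → V → ℝ) (i j : V) :
    f i j ≤ flowIn f j :=
  Finset.le_sup' (fun i => f i j) (Finset.mem_univ i)

/-- The flow carrying the maximum downstream demand on every edge of `T` and nothing elsewhere. -/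
def downstreamFlow {V : Type*} (T : Set (V × V)) (D : Finset V) (x : V → ℝ) (i j : V) : ℝ :=
  if (i, j) ∈ T then mval T D x j else 0

lemma downstreamFlow_of_mem {V : Type*} {T : Set (V × V)} {D : Finset V} {x : V → ℝ} {i j : V}
    (hij : (i, j) ∈ T) : downstreamFlow T D x i j = mval T D x j :=
  if_pos hij

lemma downstreamFlow_of_notMem {V : Type*} {T : Set (V × V)} {D : Finset V} {x : V → ℝ} {i j : V}
    (hij : (i, j) ∉ T) : downstreamFlow T D x i j = 0 :=
  if_neg hij

lemma downstreamFlow_nonneg {V : Type*} (T : Set (V × V)) (D : Finset V) (x : V → ℝ) (i j : V) :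
    0 ≤ downstreamFlow T D x i j := by
  unfold downstreamFlow
  split_ifs
  exacts [mval_nonneg T D x j, le_rfl]

lemma feasible_downstreamFlow {V : Type*} [Fintype V] [Nonempty V] [DecidableEq V]
    {E : Set (V × V)} {s : V} {D : Finset V} (hD : D.Nonempty) (hsD : s ∉ D) (x : V → ℝ)
    {T : Set (V × V)} (hTE : T ⊆ E)
    (hParentExists : ∀ v w, v ≠ s → (v, w) ∈ T → ∃ u, (u, v) ∈ T)
    (hReach : ∀ k ∈ D, Relation.ReflTransGen (fun a b => (a, b) ∈ T) s k)
    (hParent : ∀ k ∈ D, ∀ u, (u, k) ∈ T → u ∉ D) :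
    Feasible E s D hD hsD x (downstreamFlow T D x) := by
  have hne : ∀ k ∈ D, k ≠ s := fun k hk h => hsD (h ▸ hk)
  refine ⟨downstreamFlow_nonneg T D x,
    fun i j hij => downstreamFlow_of_notMem fun h => hij (hTE h), fun i hi => ?_, ?_, fun k hk => ?_⟩
  · refine Finset.sup'_le _ _ fun w _ => ?_
    by_cases hw : (i, w) ∈ T
    · obtain ⟨u, hu⟩ := hParentExists i w hi hw
      calc downstreamFlow T D x i w = mval T D x w := downstreamFlow_of_mem hw
        _ ≤ mval T D x i := mval_le_mval_of_edge hw
        _ = downstreamFlow T D x u i := (downstreamFlow_of_mem hu).symm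
        _ ≤ _ := le_flowIn _ u i
    · rw [downstreamFlow_of_notMem hw]
      exact (downstreamFlow_nonneg T D x i i).trans (le_flowIn _ i i)
  · refine Finset.sup'_le _ _ fun k hk => ?_
    obtain h | ⟨j, hsj, hjk⟩ := (hReach k hk).cases_head
    · exact absurd h.symm (hne k hk)
    · calc x k ≤ mval T D x j := le_mval hk hjk
        _ = downstreamFlow T D x s j := (downstreamFlow_of_mem hsj).symm
        _ ≤ _ := le_flowOut _ s j
  · obtain h | ⟨u, -, huk⟩ := (hReach k hk).cases_tail
    · exact absurd h (hne k hk)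
    · calc x k ≤ mval T D x k := le_mval hk .refl
        _ = downstreamFlow T D x u k := (downstreamFlow_of_mem huk).symm
        _ ≤ _ := Finset.le_sup' (fun i => downstreamFlow T D x i k)
          (Finset.mem_sdiff.mpr ⟨Finset.mem_univ u, hParent k hk u huk⟩)

/-- If the support of a feasible flow gives every vertex at most one parent, then each support
edge carries at least the maximum downstream demand. -/
lemma mval_le_of_feasible {V : Type*} [Fintype V] [Nonempty V] [DecidableEq V]
    {E : Set (V × V)} {s : V} {D : Finset V} {hD : D.Nonempty} {hsD : s ∉ D} {x : V → ℝ}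
    (hx : ∀ k ∈ D, 0 < x k) {T : Set (V × V)} {f : V → V → ℝ} (hf : Feasible E s D hD hsD x f)
    (hsIn : ∀ u, (u, s) ∉ T)
    (hUnique : ∀ u u' v, (u, v) ∈ T → (u', v) ∈ T → u = u')
    (hSupp : ∀ i j, 0 < f i j ↔ (i, j) ∈ T) {i j : V} (hij : (i, j) ∈ T) :
    mval T D x j ≤ f i j := by
  obtain ⟨hN, -, hC1, -, hC3⟩ := hf
  refine mval_le_iff.mpr ⟨hN i j, fun k hk hjk => ?_⟩
  induction hjk using Relation.ReflTransGen.head_induction_on generalizing i with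
  | refl =>
    obtain ⟨u, -, hu⟩ := (Finset.le_sup'_iff _).mp (hC3 k hk)
    rwa [hUnique i u k hij ((hSupp u k).mp ((hx k hk).trans_le hu))]
  | @head j w hjw _ ih =>
    have hjs : j ≠ s := fun h => hsIn i (h ▸ hij)
    have hIn : flowIn f j ≤ f i j := by
      refine Finset.sup'_le _ _ fun u _ => ?_
      by_cases hu : 0 < f u j
      · rw [hUnique u i j ((hSupp u j).mp hu) hij]
      · exact (not_lt.mp hu).trans (hN i j)
    exact (ih hjw).trans (((le_flowOut f j w).trans (hC1 j hjs)).trans hIn)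

/-- Lemma 1 of the paper: if `f` is an optimal flow, all edge
costs on `E` are positive, and the support of `f` is exactly the rooted tree `T`,
then the flow on every tree edge `(i,j)` equals the maximum demand among the
destinations downstream of `j`. -/
theorem optimal_flow_on_tree_edge_eq_max_downstream_demand {V : Type*} [Fintype V] [Nonempty V] [DecidableEq V]
    (E : Set (V × V)) (e : V → V → ℝ) (s : V) (D : Finset V)
    (hD : D.Nonempty) (hsD : s ∉ D) (x : V → ℝ) (hx : ∀ k ∈ D, 0 < x k)
    (T : Set (V × V)) (hTE : T ⊆ E)
    (hIncoming : ∀ v, v ≠ s → (∃ w, (v, w) ∈ T ∨ (w, v) ∈ T) → ∃! u, (u, v) ∈ T)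
    (hsIn : ∀ u, (u, s) ∉ T)
    (hTAcyc : ¬ ∃ v, Relation.TransGen (fun a b => (a, b) ∈ T) v v)
    (hReach : ∀ k ∈ D, Relation.ReflTransGen (fun a b => (a, b) ∈ T) s k)
    (hParent : ∀ k ∈ D, ∀ u, (u, k) ∈ T → u ∉ D)
    (f : V → V → ℝ)
    (hfOpt : Feasible E s D hD hsD x f ∧
      ∀ g, Feasible E s D hD hsD x g → cost e f ≤ cost e g)
    (hepos : ∀ i j, (i, j) ∈ E → 0 < e i j)
    (hSupp : ∀ i j, 0 < f i j ↔ (i, j) ∈ T) :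
    ∀ i j, (i, j) ∈ T → f i j = mval T D x j := by
  have hUnique : ∀ u u' v, (u, v) ∈ T → (u', v) ∈ T → u = u' := fun u u' v hu hu' =>
    (hIncoming v (fun h => hsIn u (h ▸ hu)) ⟨u, Or.inr hu⟩).unique hu hu'
  have hcost := hfOpt.2 _ (feasible_downstreamFlow hD hsD x hTE
    (fun v w hv hvw => (hIncoming v hv ⟨w, Or.inl hvw⟩).exists) hReach hParent)
  have hle : ∀ i j, e i j * downstreamFlow T D x i j ≤ e i j * f i j := by
    intro i j
    by_cases h : (i, j) ∈ T
    · rw [downstreamFlow_of_mem h]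
      exact mul_le_mul_of_nonneg_left
        (mval_le_of_feasible hx hfOpt.1 hsIn hUnique hSupp h) (hepos i j (hTE h)).le
    · have hf0 : f i j = 0 :=
        le_antisymm (not_lt.mp fun hpos => h ((hSupp i j).mp hpos)) (hfOpt.1.1 i j)
      rw [downstreamFlow_of_notMem h, hf0]
  intro i j hij
  have hrow : ∀ i, ∑ j, e i j * downstreamFlow T D x i j ≤ ∑ j, e i j * f i j :=
    fun i => Finset.sum_le_sum fun j _ => hle i j
  have heq := (Finset.sum_eq_sum_iff_of_le fun i _ => hrow i).mp
    (le_antisymm (Finset.sum_le_sum fun i _ => hrow i) hcost) i (Finset.mem_univ i)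
  have heq' := (Finset.sum_eq_sum_iff_of_le fun j _ => hle i j).mp heq j (Finset.mem_univ j)
  rw [← mul_left_cancel₀ (hepos i j (hTE hij)).ne' heq', downstreamFlow_of_mem hij]
end
end

section
/- If f is a feasible flow whose support digraph has no directed cycles (there is no vertex v with Relation.TransGen (→_f) v v), then every destination k ∈ D is reachable from s in the support digraph of f. -/
noncomputable section

/-- In a finite acyclic digraph in which every vertex other than `s` with an out-neighbour has an
in-neighbour, every vertex with an in-neighbour is reachable from `s`. -/
theorem Relation.reflTransGen_of_acyclic_of_exists_pred {V : Type*} [Finite V] {r : V → V → Prop}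
    {s : V} (hr : ¬ ∃ v, Relation.TransGen r v v)
    (hpred : ∀ i, i ≠ s → (∃ j, r i j) → ∃ j, r j i) {v : V} (hv : ∃ u, r u v) :
    Relation.ReflTransGen r s v := by
  have : Std.Irrefl (Relation.TransGen r) := ⟨fun v hv => hr ⟨v, hv⟩⟩
  induction v using (Finite.wellFounded_of_trans_of_irrefl (Relation.TransGen r)).induction with
  | _ v ih =>
    obtain ⟨u, huv⟩ := hv
    by_cases hus : u = s
    · subst hus
      exact .single huv
    · exact (ih u (.single huv) (hpred u hus ⟨v, huv⟩)).tail huv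

theorem flowOut_pos_of_pos {V : Type*} [Fintype V] [Nonempty V] {f : V → V → ℝ} {i j : V}
    (h : 0 < f i j) : 0 < flowOut f i :=
  (Finset.lt_sup'_iff _).mpr ⟨j, Finset.mem_univ j, h⟩

theorem exists_pos_of_flowIn_pos {V : Type*} [Fintype V] [Nonempty V] {f : V → V → ℝ} {i : V}
    (h : 0 < flowIn f i) : ∃ j, 0 < f j i := by
  obtain ⟨j, -, hj⟩ := (Finset.lt_sup'_iff _).mp h
  exact ⟨j, hj⟩

/-- if a feasible flow has an acyclic support digraph, then
every destination is reachable from the source in the support digraph. -/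
theorem acyclic_feasible_flow_reaches_destinations {V : Type*} [Fintype V] [Nonempty V] [DecidableEq V]
    (E : Set (V × V)) (e : V → V → ℝ) (s : V) (D : Finset V)
    (hD : D.Nonempty) (hsD : s ∉ D) (x : V → ℝ) (hx : ∀ k ∈ D, 0 < x k)
    (f : V → V → ℝ) (hf : Feasible E s D hD hsD x f)
    (hAcyc : ¬ ∃ v, Relation.TransGen (fun i j => 0 < f i j) v v) :
    ∀ k ∈ D, Relation.ReflTransGen (fun i j => 0 < f i j) s k := by
  obtain ⟨-, -, hC1, -, hC3⟩ := hf
  intro k hk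
  refine Relation.reflTransGen_of_acyclic_of_exists_pred hAcyc ?_ ?_
  · rintro i hi ⟨j, hij⟩
    exact exists_pos_of_flowIn_pos ((flowOut_pos_of_pos hij).trans_le (hC1 i hi))
  · obtain ⟨i, -, hik⟩ := (Finset.lt_sup'_iff _).mp ((hx k hk).trans_le (hC3 k hk))
    exact ⟨i, hik⟩
end
end

section
/- Let f be a feasible flow such that every vertex v ≠ s has at most one in-neighbor in the support digraph of f. Let k ∈ D and let v₀ = s, v₁, …, v_m = k (m ≥ 1) be vertices with f v_t v_{t+1} > 0 for all 0 ≤ t ≤ m−1 and v_t ≠ s for 1 ≤ t ≤ m. Then f v_t v_{t+1} ≥ x k for every 0 ≤ t ≤ m−1: every link on the flow-carrying path from the source to destination k carries flow at least the demand x k. -/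
noncomputable section

/-- If `a` is the only in-neighbor of `b` in the support of a nonnegative flow, then no link
into `b` carries more than the link from `a`. -/
lemma le_of_unique_inNeighbor {V : Type*} {f : V → V → ℝ} (hnonneg : ∀ i j, 0 ≤ f i j) {a b : V}
    (huniq : ∀ u, 0 < f u b → u = a) (i : V) : f i b ≤ f a b := by
  rcases (hnonneg i b).lt_or_eq with hi | hi
  · rw [huniq i hi]
  · exact hi ▸ hnonneg a b

/-- along a flow-carrying path from the source `s = v₀` to a
destination `v_m = k` in which every non-source vertex has at most one
in-neighbor in the support digraph, every link carries flow at least `x k`. -/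
theorem path_to_destination_carries_demand {V : Type*} [Fintype V] [Nonempty V] [DecidableEq V]
    (E : Set (V × V)) (e : V → V → ℝ) (s : V) (D : Finset V)
    (hD : D.Nonempty) (hsD : s ∉ D) (x : V → ℝ) (hx : ∀ k ∈ D, 0 < x k)
    (f : V → V → ℝ) (hf : Feasible E s D hD hsD x f)
    (hUniq : ∀ v, v ≠ s → ∀ u u', 0 < f u v → 0 < f u' v → u = u')
    (k : V) (hk : k ∈ D)
    (m : ℕ) (hm : 1 ≤ m) (v : ℕ → V)
    (hv0 : v 0 = s) (hvm : v m = k)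
    (hpos : ∀ t, t < m → 0 < f (v t) (v (t + 1)))
    (hns : ∀ t, 1 ≤ t → t ≤ m → v t ≠ s) :
    ∀ t, t < m → x k ≤ f (v t) (v (t + 1)) := by
  obtain ⟨hnonneg, -, hC1, -, hC3⟩ := hf
  have hmax : ∀ t, t < m → ∀ i, f i (v (t + 1)) ≤ f (v t) (v (t + 1)) := fun t ht =>
    le_of_unique_inNeighbor hnonneg fun u hu =>
      hUniq _ (hns (t + 1) (by omega) ht) _ _ hu (hpos t ht)
  intro t ht
  have hle : t ≤ m - 1 := by omega
  induction hle using Nat.decreasingInduction with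
  | self =>
    have hlast := hmax (m - 1) ht
    rw [Nat.sub_add_cancel hm, hvm] at hlast ⊢
    exact (hC3 k hk).trans (Finset.sup'_le _ _ fun i _ => hlast i)
  | of_succ t h ih =>
    have ht' : t + 1 < m := by omega
    calc x k ≤ f (v (t + 1)) (v (t + 1 + 1)) := ih ht'
      _ ≤ flowOut f (v (t + 1)) :=
        Finset.le_sup' (fun j => f (v (t + 1)) j) (Finset.mem_univ _)
      _ ≤ flowIn f (v (t + 1)) := hC1 _ (hns (t + 1) (by omega) ht'.le)
      _ ≤ f (v t) (v (t + 1)) := Finset.sup'_le _ _ fun i _ => hmax t ht i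
end
end

section
/- Let f be a feasible flow such that every vertex v ≠ s has at most one in-neighbor in the support digraph of f, and f u s = 0 for every u. Then for every pair (i,j) with f i j > 0 such that i is reachable from s in the support digraph, and every destination k ∈ D such that k = j or k is reachable from j in the support digraph, we have f i j ≥ x k. In particular, f i j is at least the maximum of the demands x k over all destinations k downstream of the link (i,j). (Lower-bound half of the paper's Lemma 1: a shared link carries at least the maximum downstream demand.) -/
noncomputable section

/-- If every non-source vertex has at most one in-neighbor in the support of `f`, no flow enters
the source, and outflow never exceeds inflow away from the source, then the flow on a link bounds
the flow on every link into a vertex downstream of it. -/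
theorem flow_le_of_downstream {V : Type*} [Fintype V] [Nonempty V] {s : V} {f : V → V → ℝ}
    (hC : ∀ i, i ≠ s → flowOut f i ≤ flowIn f i)
    (hUniq : ∀ v, v ≠ s → ∀ u u', 0 < f u v → 0 < f u' v → u = u')
    (hNoIn : ∀ u, f u s = 0) {i j k : V} (hij : 0 < f i j)
    (hjk : Relation.ReflTransGen (fun a b => 0 < f a b) j k) :
    ∀ m, f m k ≤ f i j := by
  have ne_source : ∀ {u v}, 0 < f u v → v ≠ s := by
    rintro u v huv rfl
    exact huv.ne' (hNoIn u)
  induction hjk with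
  | refl =>
    intro m
    rcases le_or_gt (f m j) 0 with hm | hm
    · exact hm.trans hij.le
    · rw [hUniq j (ne_source hij) m i hm hij]
  | @tail b c hjb hbc ih =>
    intro m
    rcases le_or_gt (f m c) 0 with hm | hm
    · exact hm.trans hij.le
    · have hbs : b ≠ s := by
        rcases Relation.ReflTransGen.cases_tail hjb with rfl | ⟨a, -, hab⟩
        · exact ne_source hij
        · exact ne_source hab
      rw [hUniq c (ne_source hbc) m b hm hbc]
      calc f b c ≤ flowOut f b := Finset.le_sup' (fun l => f b l) (Finset.mem_univ c)
        _ ≤ flowIn f b := hC b hbs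
        _ ≤ f i j := Finset.sup'_le _ _ fun a _ => ih a

/-- lower-bound half of Lemma 1: for a feasible flow in which
every non-source vertex has at most one in-neighbor in the support digraph and
no flow enters the source, every flow-carrying link reachable from the source
carries at least the demand of each destination downstream of it. -/
theorem shared_link_carries_max_downstream_demand {V : Type*} [Fintype V] [Nonempty V] [DecidableEq V]
    (E : Set (V × V)) (e : V → V → ℝ) (s : V) (D : Finset V)
    (hD : D.Nonempty) (hsD : s ∉ D) (x : V → ℝ) (hx : ∀ k ∈ D, 0 < x k)
    (f : V → V → ℝ) (hf : Feasible E s D hD hsD x f)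
    (hUniq : ∀ v, v ≠ s → ∀ u u', 0 < f u v → 0 < f u' v → u = u')
    (hNoIn : ∀ u, f u s = 0) :
    ∀ i j, 0 < f i j → Relation.ReflTransGen (fun a b => 0 < f a b) s i →
      ∀ k ∈ D, (k = j ∨ Relation.ReflTransGen (fun a b => 0 < f a b) j k) →
        x k ≤ f i j := by
  intro i j hij _ k hk hkj
  obtain ⟨-, -, hC, -, hdem⟩ := hf
  have hjk : Relation.ReflTransGen (fun a b => 0 < f a b) j k := by
    rcases hkj with rfl | h
    · exact .refl
    · exact h
  exact (hdem k hk).trans <|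
    Finset.sup'_le _ _ fun m _ => flow_le_of_downstream hC hUniq hNoIn hij hjk m
end
end

section
/- Let T ⊆ E be a set of directed edges such that: every vertex incident to a T-edge other than s has exactly one incoming T-edge; s has no incoming T-edge; T has no directed cycles; every destination k ∈ D is reachable from s along T-edges; and the unique T-parent of each destination is not a destination. For a T-edge (i,j) define m(i,j) := max({x k : k ∈ D, j = k or k is reachable from j along T-edges} ∪ {0}). Suppose f is a feasible flow whose support is exactly T (f i j > 0 iff (i,j) ∈ T) and e i j ≥ 0 for all i, j. Then cost(f) ≥ Σ_{(i,j) ∈ T} e i j · m(i,j): the cost of any feasible flow supported on the tree T is at least the cost of the canonical tree flow assigning each edge its maximum downstream demand. -/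
noncomputable section

open scoped Classical

/-- If `i` is the only tail of a positive edge into `j`, the inflow at `j` is at most `f i j`. -/
theorem flowIn_le_of_unique {V : Type*} [Fintype V] [Nonempty V] {f : V → V → ℝ} {i j : V}
    (h0 : 0 ≤ f i j) (huniq : ∀ u, 0 < f u j → u = i) : flowIn f j ≤ f i j := by
  refine Finset.sup'_le _ _ fun u _ => ?_
  by_cases hu : 0 < f u j
  · rw [huniq u hu]
  · exact (not_lt.mp hu).trans h0

/-- A feasible flow in which every positive edge `(i, j)` is the only positive edge into `j`
carries on each such edge at least the demand of every destination downstream of it. -/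
theorem demand_le_flow {V : Type*} [Fintype V] [Nonempty V] [DecidableEq V]
    {E : Set (V × V)} {s : V} {D : Finset V} {hD : D.Nonempty} {hsD : s ∉ D} {x : V → ℝ}
    {T : Set (V × V)} {f : V → V → ℝ} (hf : Feasible E s D hD hsD x f)
    (hSupp : ∀ i j, 0 < f i j ↔ (i, j) ∈ T) (hsIn : ∀ u, (u, s) ∉ T)
    (huniq : ∀ {i u j}, (i, j) ∈ T → (u, j) ∈ T → u = i)
    {k : V} (hk : k ∈ D) (hxk : 0 < x k) {j : V}
    (hjk : Relation.ReflTransGen (fun a b => (a, b) ∈ T) j k) :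
    ∀ {i}, (i, j) ∈ T → x k ≤ f i j := by
  obtain ⟨hN, -, hC1, -, hC3⟩ := hf
  induction hjk using Relation.ReflTransGen.head_induction_on with
  | refl =>
    intro i hi
    obtain ⟨u, -, hu⟩ := (Finset.le_sup'_iff _).mp (hC3 k hk)
    rwa [huniq hi ((hSupp u k).mp (hxk.trans_le hu))] at hu
  | @head a b hab _ ih =>
    intro i hi
    have has : a ≠ s := by
      rintro rfl
      exact hsIn i hi
    calc x k ≤ f a b := ih hab
      _ ≤ flowOut f a := Finset.le_sup' (fun j => f a j) (Finset.mem_univ b)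
      _ ≤ flowIn f a := hC1 a has
      _ ≤ f i a := flowIn_le_of_unique (hN i a) fun u hu => huniq hi ((hSupp u a).mp hu)

/-- A nonnegative bound on the demands downstream of `j` bounds `mval` at `j`. -/
theorem mval_le {V : Type*} {T : Set (V × V)} {D : Finset V} {x : V → ℝ} {j : V} {c : ℝ}
    (hc : 0 ≤ c)
    (h : ∀ k ∈ D, Relation.ReflTransGen (fun a b => (a, b) ∈ T) j k → x k ≤ c) :
    mval T D x j ≤ c := by
  refine (Finset.fold_max_le _).mpr ⟨hc, fun k hk => ?_⟩
  obtain ⟨hkD, rfl | hjk⟩ := Finset.mem_filter.mp hk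
  · exact h _ hkD Relation.ReflTransGen.refl
  · exact h k hkD hjk

/-- any feasible flow supported exactly on the rooted tree `T`
costs at least the canonical tree flow that assigns each tree edge its maximum
downstream demand (edge costs nonnegative). -/
theorem cost_ge_canonical_tree_flow_cost {V : Type*} [Fintype V] [Nonempty V] [DecidableEq V]
    (E : Set (V × V)) (e : V → V → ℝ) (s : V) (D : Finset V)
    (hD : D.Nonempty) (hsD : s ∉ D) (x : V → ℝ) (hx : ∀ k ∈ D, 0 < x k)
    (T : Set (V × V)) (hTE : T ⊆ E)
    (hIncoming : ∀ v, v ≠ s → (∃ w, (v, w) ∈ T ∨ (w, v) ∈ T) → ∃! u, (u, v) ∈ T)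
    (hsIn : ∀ u, (u, s) ∉ T)
    (hTAcyc : ¬ ∃ v, Relation.TransGen (fun a b => (a, b) ∈ T) v v)
    (hReach : ∀ k ∈ D, Relation.ReflTransGen (fun a b => (a, b) ∈ T) s k)
    (hParent : ∀ k ∈ D, ∀ u, (u, k) ∈ T → u ∉ D)
    (f : V → V → ℝ) (hf : Feasible E s D hD hsD x f)
    (hSupp : ∀ i j, 0 < f i j ↔ (i, j) ∈ T)
    (he : ∀ i j, 0 ≤ e i j) :
    ∑ p ∈ Finset.univ.filter (fun p : V × V => p ∈ T), e p.1 p.2 * mval T D x p.2 ≤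
      cost e f := by
  have huniq : ∀ {i u j}, (i, j) ∈ T → (u, j) ∈ T → u = i := by
    intro i u j hi hu
    have hjs : j ≠ s := by
      rintro rfl
      exact hsIn i hi
    exact (hIncoming j hjs ⟨i, Or.inr hi⟩).unique hu hi
  have hm : ∀ i j, (i, j) ∈ T → mval T D x j ≤ f i j := fun i j hij =>
    mval_le (hf.1 i j) fun k hk hjk => demand_le_flow hf hSupp hsIn huniq hk (hx k hk) hjk hij
  calc ∑ p ∈ Finset.univ.filter (fun p : V × V => p ∈ T), e p.1 p.2 * mval T D x p.2
      ≤ ∑ p ∈ Finset.univ.filter (fun p : V × V => p ∈ T), e p.1 p.2 * f p.1 p.2 :=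
        Finset.sum_le_sum fun p hp =>
          mul_le_mul_of_nonneg_left (hm p.1 p.2 (Finset.mem_filter.mp hp).2) (he p.1 p.2)
    _ ≤ ∑ p : V × V, e p.1 p.2 * f p.1 p.2 :=
        Finset.sum_le_sum_of_subset_of_nonneg (Finset.filter_subset _ _) fun p _ _ =>
          mul_nonneg (he p.1 p.2) (hf.1 p.1 p.2)
    _ = cost e f := Fintype.sum_prod_type _
end
end

section
/- Let f be a feasible flow and M a real number with M ≥ max_{k ∈ D} x k. Then the truncated flow g defined by g i j := min (f i j) M is feasible; moreover, if e i j ≥ 0 for all i, j, then cost(g) ≤ cost(f). (Truncating all link flows at the maximum demand preserves feasibility and does not increase cost.) -/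
noncomputable section

/-- The maximum of a finite family truncated at `M` is the truncation of its maximum. -/
theorem sup'_min_const {ι : Type*} (t : Finset ι) (ht : t.Nonempty) (h : ι → ℝ) (M : ℝ) :
    t.sup' ht (fun i => min (h i) M) = min (t.sup' ht h) M :=
  (Finset.sup'_inf_distrib_right ht h M).symm

/-- truncating every link flow of a feasible flow at a level
`M` at least the maximum demand preserves feasibility, and does not increase the
cost when edge costs are nonnegative. -/
theorem truncated_flow_feasible_and_cheaper {V : Type*} [Fintype V] [Nonempty V] [DecidableEq V]
    (E : Set (V × V)) (e : V → V → ℝ) (s : V) (D : Finset V)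
    (hD : D.Nonempty) (hsD : s ∉ D) (x : V → ℝ) (hx : ∀ k ∈ D, 0 < x k)
    (f : V → V → ℝ) (hf : Feasible E s D hD hsD x f)
    (M : ℝ) (hM : D.sup' hD x ≤ M) :
    Feasible E s D hD hsD x (fun i j => min (f i j) M) ∧
    ((∀ i j, 0 ≤ e i j) → cost e (fun i j => min (f i j) M) ≤ cost e f) := by
  obtain ⟨hN, hS, hC1, hC2, hC3⟩ := hf
  have hxM : ∀ k ∈ D, x k ≤ M := fun k hk => (Finset.le_sup' x hk).trans hM
  have hM0 : 0 ≤ M := by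
    obtain ⟨k, hk⟩ := hD
    exact (hx k hk).le.trans (hxM k hk)
  refine ⟨⟨fun i j => le_min (hN i j) hM0, fun i j hij => ?_, fun i hi => ?_, ?_,
    fun j hj => ?_⟩, fun he => ?_⟩
  · simp only [hS i j hij, min_eq_left hM0]
  · simp only [flowOut, flowIn, sup'_min_const]
    exact min_le_min_right M (hC1 i hi)
  · simp only [flowOut, sup'_min_const]
    exact le_min hC2 hM
  · exact (le_min (hC3 j hj) (hxM j hj)).trans_eq (sup'_min_const _ _ _ M).symm
  · exact Finset.sum_le_sum fun i _ => Finset.sum_le_sum fun j _ =>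
      mul_le_mul_of_nonneg_left (min_le_left _ _) (he i j)
end
end

section
/- If e i j ≥ 0 for all i, j and there exists at least one feasible flow, then there exists an optimal flow: a feasible flow f* such that cost(f*) ≤ cost(g) for every feasible flow g. (The minimum of the total transmission cost over the feasible set of the minimum-flow problem is attained.) -/
noncomputable section

theorem isClosed_setOf_feasible {V : Type*} [Fintype V] [Nonempty V] [DecidableEq V]
    (E : Set (V × V)) (s : V) (D : Finset V) (hD : D.Nonempty) (hsD : s ∉ D) (x : V → ℝ) :
    IsClosed {f : V → V → ℝ | Feasible E s D hD hsD x f} := by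
  have hc : ∀ i j : V, Continuous fun f : V → V → ℝ => f i j := fun i j => by fun_prop
  have hout : ∀ i : V, Continuous fun f : V → V → ℝ => flowOut f i := fun i =>
    Continuous.finset_sup'_apply _ fun j _ => hc i j
  have hin : ∀ i : V, Continuous fun f : V → V → ℝ => flowIn f i := fun i =>
    Continuous.finset_sup'_apply _ fun j _ => hc j i
  simp only [Feasible, Set.ofPred_and, Set.ofPred_forall]
  refine .inter ?_ (.inter ?_ (.inter ?_ (.inter ?_ ?_)))
  · exact isClosed_iInter fun i => isClosed_iInter fun j => isClosed_le continuous_const (hc i j)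
  · exact isClosed_iInter fun i => isClosed_iInter fun j => isClosed_iInter fun _ =>
      isClosed_eq (hc i j) continuous_const
  · exact isClosed_iInter fun i => isClosed_iInter fun _ => isClosed_le (hout i) (hin i)
  · exact isClosed_le continuous_const (hout s)
  · exact isClosed_iInter fun j => isClosed_iInter fun _ => isClosed_le continuous_const
      (Continuous.finset_sup'_apply _ fun i _ => hc i j)

/-- Capping every edge at the largest demand preserves feasibility. -/
theorem Feasible.inf_sup' {V : Type*} [Fintype V] [Nonempty V] [DecidableEq V]
    {E : Set (V × V)} {s : V} {D : Finset V} {hD : D.Nonempty} {hsD : s ∉ D} {x : V → ℝ}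
    (hx : ∀ k ∈ D, 0 < x k) {f : V → V → ℝ} (hf : Feasible E s D hD hsD x f) :
    Feasible E s D hD hsD x fun i j => f i j ⊓ D.sup' hD x := by
  obtain ⟨hN, hS, hC1, hC2, hC3⟩ := hf
  have hM : 0 ≤ D.sup' hD x :=
    (hx _ hD.choose_spec).le.trans (Finset.le_sup' x hD.choose_spec)
  refine ⟨fun i j => le_inf (hN i j) hM, fun i j hij => ?_, fun i hi => ?_, ?_, fun j hj => ?_⟩
  · simp [hS i j hij, hM]
  · have := hC1 i hi
    simp only [flowOut, flowIn] at this ⊢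
    rw [← Finset.sup'_inf_distrib_right, ← Finset.sup'_inf_distrib_right]
    exact inf_le_inf_right _ this
  · simp only [flowOut] at hC2 ⊢
    rw [← Finset.sup'_inf_distrib_right]
    exact le_inf hC2 le_rfl
  · exact (le_inf (hC3 j hj) (Finset.le_sup' x hj)).trans_eq
      (Finset.sup'_inf_distrib_right _ _ _)

/-- if edge costs are nonnegative and some feasible flow
exists, then an optimal flow exists: the minimum total transmission cost over
the feasible set is attained. -/
theorem exists_optimal_flow {V : Type*} [Fintype V] [Nonempty V] [DecidableEq V]
    (E : Set (V × V)) (e : V → V → ℝ) (s : V) (D : Finset V)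
    (hD : D.Nonempty) (hsD : s ∉ D) (x : V → ℝ) (hx : ∀ k ∈ D, 0 < x k)
    (he : ∀ i j, 0 ≤ e i j)
    (hex : ∃ f : V → V → ℝ, Feasible E s D hD hsD x f) :
    ∃ f : V → V → ℝ, Feasible E s D hD hsD x f ∧
      ∀ g : V → V → ℝ, Feasible E s D hD hsD x g → cost e f ≤ cost e g := by
  set M := D.sup' hD x
  have hK : IsCompact ({f : V → V → ℝ | Feasible E s D hD hsD x f} ∩
      Set.Icc (fun _ _ => 0) (fun _ _ => M)) :=
    isCompact_Icc.inter_left (isClosed_setOf_feasible E s D hD hsD x)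
  have hcap : ∀ g : V → V → ℝ, Feasible E s D hD hsD x g →
      (fun i j => g i j ⊓ M) ∈ {f : V → V → ℝ | Feasible E s D hD hsD x f} ∩
        Set.Icc (fun _ _ => 0) (fun _ _ => M) := fun g hg =>
    ⟨hg.inf_sup' hx, (hg.inf_sup' hx).1, fun _ _ => inf_le_right⟩
  obtain ⟨f₀, hf₀⟩ := hex
  have hcost : Continuous fun f : V → V → ℝ => cost e f := by
    unfold cost
    fun_prop
  obtain ⟨f, hf, hmin⟩ := hK.exists_isMinOn ⟨_, hcap f₀ hf₀⟩ hcost.continuousOn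
  refine ⟨f, hf.1, fun g hg => (hmin (hcap g hg)).trans ?_⟩
  exact Finset.sum_le_sum fun i _ => Finset.sum_le_sum fun j _ =>
    mul_le_mul_of_nonneg_left inf_le_left (he i j)
end
end

section
/- Let f be a feasible flow and v a vertex with v ∉ D, v ≠ s, and f v j = 0 for every j (v has no outflow), and suppose there exists j₀ ≠ v with f s j₀ ≥ max_{k ∈ D} x k. Define g by g i v := 0 for all i, and g i j := f i j for all i and all j ≠ v. Then g is feasible; if e i j ≥ 0 for all i, j, then cost(g) ≤ cost(f); and if additionally e i v > 0 and f i v > 0 for some i, then cost(g) < cost(f). (Pruning the inflow of a non-destination dead-end node preserves feasibility and strictly reduces cost when that inflow is positive on a positively-priced link.) -/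
noncomputable section

/-- pruning the inflow of a non-destination, non-source node
with no outflow preserves feasibility, does not increase cost when edge costs
are nonnegative, and strictly decreases cost if some pruned inflow is positive
on a positively-priced link. -/
theorem prune_dead_end_inflow {V : Type*} [Fintype V] [Nonempty V] [DecidableEq V]
    (E : Set (V × V)) (e : V → V → ℝ) (s : V) (D : Finset V)
    (hD : D.Nonempty) (hsD : s ∉ D) (x : V → ℝ) (hx : ∀ k ∈ D, 0 < x k)
    (f : V → V → ℝ) (hf : Feasible E s D hD hsD x f)
    (v : V) (hvD : v ∉ D) (hvs : v ≠ s)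
    (hvOut : ∀ j, f v j = 0)
    (hj₀ : ∃ j₀, j₀ ≠ v ∧ D.sup' hD x ≤ f s j₀) :
    Feasible E s D hD hsD x (fun i j => if j = v then 0 else f i j) ∧
    ((∀ i j, 0 ≤ e i j) →
      cost e (fun i j => if j = v then 0 else f i j) ≤ cost e f ∧
      ((∃ i, 0 < e i v ∧ 0 < f i v) →
        cost e (fun i j => if j = v then 0 else f i j) < cost e f)) := by
  obtain ⟨hN, hS, hC1, hC2, hC3⟩ := hf
  obtain ⟨j₀, hj₀v, hj₀⟩ := hj₀
  have hle : ∀ i j, (if j = v then 0 else f i j) ≤ f i j := by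
    intro i j
    split_ifs
    · exact hN i j
    · exact le_rfl
  refine ⟨⟨?_, ?_, ?_, ?_, ?_⟩, ?_⟩
  · intro i j
    dsimp only
    split_ifs
    · exact le_rfl
    · exact hN i j
  · intro i j hij
    simp [hS i j hij]
  · intro i his
    by_cases hiv : i = v
    · subst hiv
      simp [flowOut, flowIn, hvOut]
    · have hin : flowIn (fun i j => if j = v then 0 else f i j) i = flowIn f i := by
        simp [flowIn, hiv]
      rw [hin]
      refine le_trans ?_ (hC1 i his)
      exact Finset.sup'_mono_fun fun j _ => hle i j
  · refine hj₀.trans ?_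
    have h := Finset.le_sup' (fun j => if j = v then 0 else f s j) (Finset.mem_univ j₀)
    simpa only [flowOut, if_neg hj₀v] using h
  · intro j hj
    have hjv : j ≠ v := fun h => hvD (h ▸ hj)
    simpa only [if_neg hjv] using hC3 j hj
  · intro he
    have hterm : ∀ i j, e i j * (if j = v then 0 else f i j) ≤ e i j * f i j :=
      fun i j => mul_le_mul_of_nonneg_left (hle i j) (he i j)
    refine ⟨Finset.sum_le_sum fun i _ => Finset.sum_le_sum fun j _ => hterm i j, ?_⟩
    rintro ⟨i, hei, hfi⟩
    refine Finset.sum_lt_sum (fun i _ => Finset.sum_le_sum fun j _ => hterm i j)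
      ⟨i, Finset.mem_univ i, Finset.sum_lt_sum (fun j _ => hterm i j) ⟨v, Finset.mem_univ v, ?_⟩⟩
    simpa using mul_pos hei hfi
end
end

section
/- Let f be an optimal flow and suppose e i j > 0 for every (i,j) ∈ E. Let v be a vertex with v ∉ D, v ≠ s, f v j = 0 for every j, and suppose there exists j₀ ≠ v with f s j₀ ≥ max_{k ∈ D} x k. Then f i v = 0 for every i: in an optimal solution, no flow enters a non-destination node with no outflow (the non-destination-leaf pruning step in the proof of the paper's Theorem 1). -/
noncomputable section

/-- the non-destination-leaf pruning step in Theorem 1: in an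
optimal flow with strictly positive edge costs on `E`, no flow enters a
non-destination, non-source node with no outflow. -/
theorem optimal_flow_no_inflow_to_dead_end {V : Type*} [Fintype V] [Nonempty V] [DecidableEq V]
    (E : Set (V × V)) (e : V → V → ℝ) (s : V) (D : Finset V)
    (hD : D.Nonempty) (hsD : s ∉ D) (x : V → ℝ) (hx : ∀ k ∈ D, 0 < x k)
    (f : V → V → ℝ)
    (hfOpt : Feasible E s D hD hsD x f ∧
      ∀ g, Feasible E s D hD hsD x g → cost e f ≤ cost e g)
    (hepos : ∀ i j, (i, j) ∈ E → 0 < e i j)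
    (v : V) (hvD : v ∉ D) (hvs : v ≠ s)
    (hvOut : ∀ j, f v j = 0)
    (hj₀ : ∃ j₀, j₀ ≠ v ∧ D.sup' hD x ≤ f s j₀) :
    ∀ i, f i v = 0 := by
  obtain ⟨⟨hN, hS, hC1, hC2, hC3⟩, hopt⟩ := hfOpt
  obtain ⟨j₀, hj₀v, hj₀⟩ := hj₀
  let g : V → V → ℝ := fun i j => if j = v then 0 else f i j
  have hg_ne : ∀ i j, j ≠ v → g i j = f i j := fun i j h => if_neg h
  have hg_v : ∀ i, g i v = 0 := fun i => if_pos rfl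
  have hg_le : ∀ i j, g i j ≤ f i j := by
    intro i j
    by_cases h : j = v
    · rw [h, hg_v]
      exact hN i v
    · exact (hg_ne i j h).le
  have hg : Feasible E s D hD hsD x g := by
    refine ⟨fun i j => ?_, fun i j hij => ?_, fun i hi => ?_, ?_, fun j hj => ?_⟩
    · by_cases h : j = v
      · rw [h, hg_v]
      · exact (hg_ne i j h).symm ▸ hN i j
    · by_cases h : j = v
      · rw [h, hg_v]
      · rw [hg_ne i j h, hS i j hij]
    · by_cases h : i = v
      · subst h
        simp only [flowIn, hg_v, Finset.sup'_const]
        exact Finset.sup'_le _ _ fun j _ => (hg_le i j).trans (hvOut j).le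
      · have hin : flowIn g i = flowIn f i := by
          simp only [flowIn, hg_ne _ i h]
        rw [hin]
        refine le_trans ?_ (hC1 i hi)
        exact Finset.sup'_mono_fun fun j _ => hg_le i j
    · refine hj₀.trans ?_
      rw [← hg_ne s j₀ hj₀v]
      exact Finset.le_sup' (fun j => g s j) (Finset.mem_univ j₀)
    · have h : j ≠ v := fun h => hvD (h ▸ hj)
      simpa only [hg_ne _ j h] using hC3 j hj
  have hterm : ∀ i j, e i j * g i j ≤ e i j * f i j := by
    intro i j
    by_cases hE : (i, j) ∈ E
    · exact mul_le_mul_of_nonneg_left (hg_le i j) (hepos i j hE).le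
    · rw [hS i j hE, hg.2.1 i j hE]
  intro i
  by_contra hne
  have hE : (i, v) ∈ E := by
    by_contra h
    exact hne (hS i v h)
  refine (hopt g hg).not_gt ?_
  refine Finset.sum_lt_sum (fun k _ => Finset.sum_le_sum fun j _ => hterm k j)
    ⟨i, Finset.mem_univ i, ?_⟩
  refine Finset.sum_lt_sum (fun j _ => hterm i j) ⟨v, Finset.mem_univ v, ?_⟩
  rw [hg_v, mul_zero]
  exact mul_pos (hepos i v hE) ((hN i v).lt_of_ne' hne)
end
end
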